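/- Let 𝒰 be an update family with diameter D and let u be an isolated stable direction of 𝒰. Then α(u) ≤ D; indeed, there is a set Z consisting of at most D consecutive sites of l_u such that [H_u ∪ Z]∖H_u is infinite. -/

import Mathlib

open scoped Classical

/-- A site of the two-dimensional lattice. -/
abbrev Site : Type := ℤ × ℤ

/-- An update family: a finite nonempty collection of finite nonempty rules,
none containing the origin. We represent the collection as a `Finset (Finset Site)`
together with this well-formedness predicate. -/
def IsUpdateFamily (𝒰 : Finset (Finset Site)) : Prop :=
  𝒰.Nonempty ∧ ∀ U ∈ 𝒰, U.Nonempty ∧ ((0, 0) : Site) ∉ U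

/-- One step of the bootstrap percolation dynamics. -/
def bpStep (𝒰 : Finset (Finset Site)) (A : Set Site) : Set Site :=
  A ∪ {x : Site | ∃ U ∈ 𝒰, ∀ y ∈ U, x + y ∈ A}

/-- The configuration after `t` steps of the dynamics started from `A`. -/
def bpIter (𝒰 : Finset (Finset Site)) (A : Set Site) : ℕ → Set Site
  | 0 => A
  | n + 1 => bpStep 𝒰 (bpIter 𝒰 A n)

/-- The closure `[A]` of a set `A` under the bootstrap dynamics. -/
def bpClosure (𝒰 : Finset (Finset Site)) (A : Set Site) : Set Site :=
  ⋃ n : ℕ, bpIter 𝒰 A n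

/-- The unit circle `S¹ ⊆ ℝ²`. -/
def sphere2 : Set (ℝ × ℝ) := {u : ℝ × ℝ | u.1 ^ 2 + u.2 ^ 2 = 1}

/-- Inner product of a lattice site with a real vector. -/
def inner2 (x : Site) (u : ℝ × ℝ) : ℝ := (x.1 : ℝ) * u.1 + (x.2 : ℝ) * u.2

/-- The open half-plane `H_u` with outer normal `u`. -/
def halfPlane (u : ℝ × ℝ) : Set Site := {x : Site | inner2 x u < 0}

/-- The lattice line `l_u` through the origin perpendicular to `u`. -/
def lineu (u : ℝ × ℝ) : Set Site := {x : Site | inner2 x u = 0}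

/-- A direction `u` is unstable if some rule lies in `H_u`. -/
def Unstable (𝒰 : Finset (Finset Site)) (u : ℝ × ℝ) : Prop :=
  ∃ U ∈ 𝒰, (U : Set Site) ⊆ halfPlane u

/-- A direction of the unit circle is stable if it is not unstable. -/
def Stable (𝒰 : Finset (Finset Site)) (u : ℝ × ℝ) : Prop :=
  u ∈ sphere2 ∧ ¬ Unstable 𝒰 u

/-- The set of stable directions. -/
def stableSet (𝒰 : Finset (Finset Site)) : Set (ℝ × ℝ) := {u | Stable 𝒰 u}

/-- An isolated stable direction: a stable direction not in the (topological)
closure of the set of other stable directions. -/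
def IsolatedStable (𝒰 : Finset (Finset Site)) (u : ℝ × ℝ) : Prop :=
  Stable 𝒰 u ∧ u ∉ closure (stableSet 𝒰 \ {u})

/-- The open semicircle of the unit circle centred at the direction `v`. -/
def openSemicircle (v : ℝ × ℝ) : Set (ℝ × ℝ) :=
  {u ∈ sphere2 | 0 < u.1 * v.1 + u.2 * v.2}

/-- A family is supercritical if some open semicircle consists of unstable directions. -/
def Supercritical (𝒰 : Finset (Finset Site)) : Prop :=
  ∃ v ∈ sphere2, ∀ u ∈ openSemicircle v, Unstable 𝒰 u

/-- A family is critical if it is not supercritical and some open semicircle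
contains only finitely many stable directions. -/
def Critical (𝒰 : Finset (Finset Site)) : Prop :=
  ¬ Supercritical 𝒰 ∧ ∃ v ∈ sphere2, (stableSet 𝒰 ∩ openSemicircle v).Finite

/-- The difficulty `α(u)` of a direction: `0` for unstable directions, `∞` for
non-isolated stable directions, and for isolated stable directions the minimum
cardinality of a finite `Z ⊆ ℤ² ∖ H_u` such that `[H_u ∪ Z] ∖ H_u` is infinite. -/
noncomputable def dirDifficulty (𝒰 : Finset (Finset Site)) (u : ℝ × ℝ) : ℕ∞ :=
  if Unstable 𝒰 u then 0
  else if IsolatedStable 𝒰 u then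
    sInf {n : ℕ∞ | ∃ Z : Finset Site, (∀ z ∈ Z, z ∉ halfPlane u) ∧
      (bpClosure 𝒰 (halfPlane u ∪ (Z : Set Site)) \ halfPlane u).Infinite ∧ n = Z.card}
  else ⊤

/-- The difficulty `α(𝒰)` of an update family. -/
noncomputable def difficulty (𝒰 : Finset (Finset Site)) : ℕ∞ :=
  ⨅ v ∈ sphere2, ⨆ u ∈ openSemicircle v, dirDifficulty 𝒰 u

/-- The diameter `D` of an update family: `2 · max{‖x‖_∞ : x ∈ ⋃ U ∈ 𝒰, U}`. -/
def famDiam (𝒰 : Finset (Finset Site)) : ℕ :=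
  2 * 𝒰.sup (fun U => U.sup (fun x => max x.1.natAbs x.2.natAbs))

lemma inner2_add (x y : Site) (u : ℝ × ℝ) : inner2 (x + y) u = inner2 x u + inner2 y u := by
  simp only [inner2, Prod.fst_add, Prod.snd_add]
  push_cast
  ring

lemma inner2_zsmul (k : ℤ) (x : Site) (u : ℝ × ℝ) : inner2 (k • x) u = k * inner2 x u := by
  simp only [inner2, Prod.smul_fst, Prod.smul_snd, smul_eq_mul]
  push_cast
  ring

lemma bpIter_mono (𝒰 : Finset (Finset Site)) (A : Set Site) : Monotone (bpIter 𝒰 A) :=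
  monotone_nat_of_le_succ fun _ => Set.subset_union_left

lemma subset_bpClosure (𝒰 : Finset (Finset Site)) (A : Set Site) : A ⊆ bpClosure 𝒰 A :=
  Set.subset_iUnion (bpIter 𝒰 A) 0

/-- The closure is closed under the rules. -/
lemma mem_bpClosure_of_rule {𝒰 : Finset (Finset Site)} {A : Set Site} {U : Finset Site}
    (hU : U ∈ 𝒰) {x : Site} (h : ∀ y ∈ U, x + y ∈ bpClosure 𝒰 A) : x ∈ bpClosure 𝒰 A := by
  simp only [bpClosure, Set.mem_iUnion] at h ⊢
  choose! t ht using h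
  exact ⟨U.sup t + 1, Or.inr ⟨U, hU, fun y hy =>
    bpIter_mono 𝒰 A (Finset.le_sup (f := t) hy) (ht y hy)⟩⟩

/-- The direction `u` rotated by the angle `θ`. -/
noncomputable def rotated (u : ℝ × ℝ) (θ : ℝ) : ℝ × ℝ :=
  (u.1 * Real.cos θ - u.2 * Real.sin θ, u.2 * Real.cos θ + u.1 * Real.sin θ)

lemma rotated_mem_sphere2 {u : ℝ × ℝ} (hu : u ∈ sphere2) (θ : ℝ) : rotated u θ ∈ sphere2 := by
  simp only [sphere2, Set.mem_ofPred_eq, rotated] at hu ⊢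
  linear_combination hu + (u.1 ^ 2 + u.2 ^ 2) * Real.sin_sq_add_cos_sq θ

lemma inner2_rotated (x : Site) (u : ℝ × ℝ) (θ : ℝ) :
    inner2 x (rotated u θ) =
      Real.cos θ * inner2 x u + Real.sin θ * inner2 x (-u.2, u.1) := by
  simp only [inner2, rotated]
  ring

lemma rotated_ne {u : ℝ × ℝ} (hu : u ∈ sphere2) {θ : ℝ} (hθ : 0 < Real.sin θ) :
    rotated u θ ≠ u := by
  intro h
  simp only [rotated, Prod.ext_iff] at h
  simp only [sphere2, Set.mem_ofPred_eq] at hu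
  have : Real.sin θ = 0 := by
    linear_combination (-u.2) * h.1 + u.1 * h.2 - Real.sin θ * hu
  exact hθ.ne' this

lemma continuous_rotated (u : ℝ × ℝ) : Continuous (rotated u) := by
  unfold rotated
  fun_prop

/-- Near an isolated stable direction there is a rule contained in the closed half-plane whose
sites on the boundary line all lie strictly on one side of the origin. -/
lemma IsolatedStable.exists_rule {𝒰 : Finset (Finset Site)} {u : ℝ × ℝ}
    (hu : IsolatedStable 𝒰 u) :
    ∃ U ∈ 𝒰, ∀ x ∈ U, inner2 x u < 0 ∨ (inner2 x u = 0 ∧ inner2 x (-u.2, u.1) < 0) := by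
  have hlim : Filter.Tendsto (rotated u) (nhdsWithin 0 (Set.Ioi 0)) (nhds u) := by
    have h := (continuous_rotated u).tendsto 0
    rw [show rotated u 0 = u by simp [rotated]] at h
    exact h.mono_left nhdsWithin_le_nhds
  have hfar : ∀ᶠ θ in nhdsWithin (0 : ℝ) (Set.Ioi 0), rotated u θ ∉ stableSet 𝒰 \ {u} :=
    (hlim.eventually (isClosed_closure.isOpen_compl.mem_nhds hu.2)).mono
      fun _ h h' => h (subset_closure h')
  have hpos : ∀ᶠ θ in nhdsWithin (0 : ℝ) (Set.Ioi 0), ∀ U ∈ 𝒰, ∀ x ∈ U,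
      0 < inner2 x u → 0 < inner2 x (rotated u θ) := by
    simp only [Filter.eventually_all_finset]
    intro U _ x _
    by_cases hx : 0 < inner2 x u
    · have hcont : Continuous (inner2 x) := by
        unfold inner2
        fun_prop
      filter_upwards [((hcont.tendsto u).comp hlim).eventually (lt_mem_nhds hx)] with θ h _ using h
    · exact Filter.Eventually.of_forall fun _ h => absurd h hx
  have hsin : ∀ᶠ θ in nhdsWithin (0 : ℝ) (Set.Ioi 0), 0 < Real.sin θ := by
    filter_upwards [Ioo_mem_nhdsGT Real.pi_pos] with θ h using Real.sin_pos_of_mem_Ioo h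
  obtain ⟨θ, hfar, hpos, hsin⟩ := (hfar.and (hpos.and hsin)).exists
  have hunst : Unstable 𝒰 (rotated u θ) := by
    by_contra h
    exact hfar ⟨⟨rotated_mem_sphere2 hu.1.1 θ, h⟩, rotated_ne hu.1.1 hsin⟩
  obtain ⟨U, hU, hsub⟩ := hunst
  refine ⟨U, hU, fun x hx => ?_⟩
  have hneg : inner2 x (rotated u θ) < 0 := hsub hx
  rcases lt_trichotomy (inner2 x u) 0 with h | h | h
  · exact Or.inl h
  · rw [inner2_rotated, h, mul_zero, zero_add] at hneg
    exact Or.inr ⟨h, (pos_iff_neg_of_mul_neg hneg).1 hsin⟩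
  · exact absurd hneg (hpos U hU x hx h).le.not_gt

/-- A lattice line containing a nonzero site is generated by a single site, of which the given
site is a positive multiple. -/
lemma exists_generator_lineu {u : ℝ × ℝ} (hu : u ∈ sphere2) {w : Site} (hw : w ∈ lineu u)
    (hw0 : w ≠ (0, 0)) :
    ∃ v : Site, v ≠ (0, 0) ∧ lineu u = {x : Site | ∃ k : ℤ, x = k • v} ∧
      ∃ g : ℤ, 0 < g ∧ w = g • v := by
  obtain ⟨a, b⟩ := w
  have hg : 0 < Int.gcd a b := by
    rw [Int.gcd_pos_iff]
    by_contra! h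
    exact hw0 (Prod.ext h.1 h.2)
  obtain ⟨a', b', hcop, ha, hb⟩ := Int.exists_gcd_one hg
  have hgz : (0 : ℤ) < Int.gcd a b := by exact_mod_cast hg
  have hwv : ((a, b) : Site) = (Int.gcd a b : ℤ) • ((a', b') : Site) := by
    refine Prod.ext ?_ ?_
    · simpa [mul_comm] using ha
    · simpa [mul_comm] using hb
  have hv : inner2 (a', b') u = 0 := by
    have h : inner2 (a, b) u = 0 := hw
    rw [hwv, inner2_zsmul] at h
    exact (mul_eq_zero.1 h).resolve_left (by exact_mod_cast hgz.ne')
  have hv0 : ((a', b') : Site) ≠ (0, 0) := by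
    intro h
    rw [h] at hwv
    exact hw0 (by simpa using hwv)
  refine ⟨(a', b'), hv0, ?_, _, hgz, hwv⟩
  ext ⟨p, q⟩
  simp only [lineu, Set.mem_ofPred_eq]
  constructor
  · intro hpq
    have hcross : p * b' = q * a' := by
      simp only [inner2] at hpq hv
      simp only [sphere2, Set.mem_ofPred_eq] at hu
      have : (p : ℝ) * b' = q * a' := by
        linear_combination (-((p : ℝ) * b' - q * a')) * hu +
          (b' * u.1 - a' * u.2) * hpq + (-(q : ℝ) * u.1 + p * u.2) * hv
      exact_mod_cast this
    obtain ⟨r, s, hrs⟩ := Int.isCoprime_iff_gcd_eq_one.2 hcop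
    refine ⟨p * r + q * s, Prod.ext ?_ ?_⟩
    · simp only [Prod.smul_fst, smul_eq_mul]
      linear_combination (-p) * hrs + s * hcross
    · simp only [Prod.smul_snd, smul_eq_mul]
      linear_combination (-q) * hrs - r * hcross
  · rintro ⟨k, hk⟩
    rw [hk, inner2_zsmul, hv, mul_zero]

lemma natAbs_le_of_zsmul {k : ℤ} {v : Site} (hv : v ≠ (0, 0)) :
    k.natAbs ≤ max (k • v).1.natAbs (k • v).2.natAbs := by
  simp only [Prod.smul_fst, Prod.smul_snd, smul_eq_mul, Int.natAbs_mul]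
  by_cases h : v.1 = 0
  · have h2 : v.2 ≠ 0 := fun h2 => hv (Prod.ext h h2)
    exact le_max_of_le_right (Nat.le_mul_of_pos_right _ (Int.natAbs_pos.2 h2))
  · exact le_max_of_le_left (Nat.le_mul_of_pos_right _ (Int.natAbs_pos.2 h))

/-- If a rule lies in the half-plane together with the multiples `v, …, M • v`, then `M`
consecutive sites of the line infect a whole ray. -/
lemma neg_smul_mem_bpClosure {𝒰 : Finset (Finset Site)} {u : ℝ × ℝ} {U : Finset Site}
    (hU : U ∈ 𝒰) {v : Site} (hv : inner2 v u = 0) {M : ℕ} {A : Set Site}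
    (hA : halfPlane u ⊆ A) (hZ : ∀ i < M, (i : ℤ) • v ∈ A)
    (hrule : ∀ x ∈ U, inner2 x u < 0 ∨ ∃ k : ℕ, 1 ≤ k ∧ k ≤ M ∧ x = (k : ℤ) • v) (n : ℕ) :
    (-((n : ℤ) + 1)) • v ∈ bpClosure 𝒰 A := by
  induction n using Nat.strong_induction_on with
  | _ n ih =>
    refine mem_bpClosure_of_rule hU fun x hx => ?_
    rcases hrule x hx with h | ⟨k, hk1, hkM, rfl⟩
    · refine subset_bpClosure _ _ (hA ?_)
      rw [halfPlane, Set.mem_ofPred_eq, inner2_add, inner2_zsmul, hv, mul_zero, zero_add]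
      exact h
    · rw [← add_smul]
      rcases Nat.lt_or_ge n k with h | h
      · have := subset_bpClosure 𝒰 A (hZ (k - (n + 1)) (by omega))
        convert this using 2
        omega
      · convert ih (n - k) (by omega) using 2
        omega


/-- for an isolated stable direction `u` of a family with diameter
`D`, one has `α(u) ≤ D`; indeed some set of at most `D` consecutive sites of the
line `l_u` (an arithmetic progression along a generator `v` of the lattice line)
makes `[H_u ∪ Z] ∖ H_u` infinite. -/
theorem difficulty_le_diam (𝒰 : Finset (Finset Site)) (h𝒰 : IsUpdateFamily 𝒰)
    (u : ℝ × ℝ) (hu : IsolatedStable 𝒰 u) :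
    dirDifficulty 𝒰 u ≤ (famDiam 𝒰 : ℕ∞) ∧
      ∃ (n : ℕ) (x₀ v : Site), n ≤ famDiam 𝒰 ∧ v ≠ (0, 0) ∧
        lineu u = {x : Site | ∃ k : ℤ, x = x₀ + k • v} ∧
        (bpClosure 𝒰
            (halfPlane u ∪ (((Finset.range n).image (fun i => x₀ + (i : ℤ) • v) : Finset Site) : Set Site))
          \ halfPlane u).Infinite := by
  obtain ⟨U, hU, hside⟩ := hu.exists_rule
  obtain ⟨w, hwU, hw⟩ : ∃ w ∈ U, ¬ inner2 w u < 0 := by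
    by_contra! h
    exact hu.1.2 ⟨U, hU, h⟩
  obtain ⟨hwl, hwneg⟩ := (hside w hwU).resolve_left hw
  have hw0 : w ≠ (0, 0) := fun h => (h𝒰.2 U hU).2 (h ▸ hwU)
  obtain ⟨v, hv0, hline, g, hg, hwg⟩ := exists_generator_lineu hu.1.1 hwl hw0
  have hv : inner2 v u = 0 := by
    have : v ∈ lineu u := by
      rw [hline]
      exact ⟨1, (one_smul ℤ v).symm⟩
    exact this
  have hvneg : inner2 v (-u.2, u.1) < 0 := by
    rw [hwg, inner2_zsmul] at hwneg
    exact (pos_iff_neg_of_mul_neg hwneg).1 (by exact_mod_cast hg)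
  set M : ℕ := 𝒰.sup (fun U => U.sup (fun x => max x.1.natAbs x.2.natAbs)) with hM
  have hMD : M ≤ famDiam 𝒰 := by
    rw [famDiam, ← hM]
    omega
  have hrule : ∀ x ∈ U, inner2 x u < 0 ∨ ∃ k : ℕ, 1 ≤ k ∧ k ≤ M ∧ x = (k : ℤ) • v := by
    intro x hx
    refine (hside x hx).imp_right fun ⟨hxl, hxneg⟩ => ?_
    have hxline : x ∈ lineu u := hxl
    rw [hline] at hxline
    obtain ⟨k, rfl⟩ := hxline
    rw [inner2_zsmul] at hxneg
    have hk : 0 < k := by exact_mod_cast (pos_iff_neg_of_mul_neg hxneg).2 hvneg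
    have hkM : k.natAbs ≤ M :=
      (natAbs_le_of_zsmul hv0).trans
        ((Finset.le_sup (f := fun x : Site => max x.1.natAbs x.2.natAbs) hx).trans
          (Finset.le_sup
            (f := fun U : Finset Site => U.sup fun x => max x.1.natAbs x.2.natAbs) hU))
    refine ⟨k.natAbs, by omega, hkM, ?_⟩
    rw [Int.natAbs_of_nonneg hk.le]
  set Z : Finset Site := (Finset.range M).image (fun i : ℕ => (0 : Site) + (i : ℤ) • v) with hZ
  have hinf : (bpClosure 𝒰 (halfPlane u ∪ (Z : Set Site)) \ halfPlane u).Infinite := by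
    refine Set.infinite_of_injective_forall_mem (f := fun n : ℕ => (-((n : ℤ) + 1)) • v) ?_ ?_
    · intro m n h
      have := smul_left_injective ℤ (show v ≠ 0 from hv0) h
      omega
    · intro n
      refine ⟨neg_smul_mem_bpClosure hU hv Set.subset_union_left (fun i hi => Or.inr ?_) hrule n,
        ?_⟩
      · rw [hZ, Finset.mem_coe, Finset.mem_image]
        exact ⟨i, Finset.mem_range.2 hi, zero_add _⟩
      · rw [halfPlane, Set.mem_ofPred_eq, inner2_zsmul, hv, mul_zero]
        exact lt_irrefl 0
  refine ⟨?_, M, 0, v, hMD, hv0, ?_, ?_⟩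
  · rw [dirDifficulty, if_neg hu.1.2, if_pos hu]
    refine le_trans (b := (Z.card : ℕ∞)) (sInf_le ?_) ?_
    · refine ⟨Z, fun z hz => ?_, hinf, rfl⟩
      obtain ⟨i, -, rfl⟩ := Finset.mem_image.1 hz
      rw [zero_add, halfPlane, Set.mem_ofPred_eq, inner2_zsmul, hv, mul_zero]
      exact lt_irrefl 0
    · have : Z.card ≤ M := Finset.card_image_le.trans (Finset.card_range M).le
      exact_mod_cast this.trans hMD
  · simpa only [zero_add] using hline
  · convert hinf using 4
    ext z
    simp [hZ]
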